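/- Let n ≥ 2 and let d ≥ 1 be an integer with gcd(d, n−1) > 1. Then T_n contains no element of order d. In particular, for n > 2 the group T_n contains no element of order n−1. -/

import Mathlib

noncomputable section

namespace ThompsonPaper

/-- The circle `ℝ/ℤ`. -/
abbrev Circle : Type := AddCircle (1 : ℝ)

/-- Homeomorphisms of a topological space form a group under composition,
with `(f * g) x = f (g x)`. -/
instance homeoGroup {α : Type*} [TopologicalSpace α] : Group (α ≃ₜ α) where
  mul f g := g.trans f
  one := Homeomorph.refl α
  inv := Homeomorph.symm
  mul_assoc _ _ _ := Homeomorph.ext fun _ => rfl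
  one_mul _ := Homeomorph.ext fun _ => rfl
  mul_one _ := Homeomorph.ext fun _ => rfl
  inv_mul_cancel f := Homeomorph.ext fun x => f.symm_apply_apply x

/-- `x` is an `n`-adic rational: `x = a / n ^ k` with `a` an integer, `k` a natural number. -/
def IsNAdic (n : ℕ) (x : ℝ) : Prop := ∃ a : ℤ, ∃ k : ℕ, x = (a : ℝ) / (n : ℝ) ^ k

/-- The set of `n`-adic points of the circle. -/
def nAdicPoints (n : ℕ) : Set Circle := { p | ∃ x : ℝ, IsNAdic n x ∧ p = (x : Circle) }

/-- `F : ℝ → ℝ` is a lift of the circle map `f`. -/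
def IsLift (f : Circle ≃ₜ Circle) (F : ℝ → ℝ) : Prop :=
  ∀ x : ℝ, f (x : Circle) = ((F x : ℝ) : Circle)

/-- `F : ℝ → ℝ` commutes with translation by `1` and is piecewise affine with finitely
many breakpoints (modulo `1`), all breakpoints at `n`-adic rationals, and with the slope
of every affine piece an integer power of `n`. -/
def PiecewiseNAffine (n : ℕ) (F : ℝ → ℝ) : Prop :=
  (∀ x : ℝ, F (x + 1) = F x + 1) ∧
  ∃ m : ℕ, ∃ t : ℕ → ℝ, ∃ slope : ℕ → ℤ, ∃ c : ℕ → ℝ,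
    0 < m ∧ t 0 = 0 ∧ t m = 1 ∧
    (∀ i, i < m → t i < t (i + 1)) ∧
    (∀ i, i ≤ m → IsNAdic n (t i)) ∧
    (∀ i, i < m → ∀ x ∈ Set.Icc (t i) (t (i + 1)),
      F x = (n : ℝ) ^ (slope i) * x + c i)

/-- Membership in Thompson's group `T_n`: an orientation-preserving homeomorphism of the
circle `ℝ/ℤ` mapping the set of `n`-adic points onto itself, which is piecewise affine
with finitely many breakpoints, all breakpoints at `n`-adic points, and all slopes integer
powers of `n`.  (Orientation preservation and the piecewise affine structure are expressed
through a strictly increasing lift.) -/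
def InT (n : ℕ) (f : Circle ≃ₜ Circle) : Prop :=
  f '' nAdicPoints n = nAdicPoints n ∧
  ∃ F : ℝ → ℝ, StrictMono F ∧ IsLift f F ∧ PiecewiseNAffine n F

/-- Thompson's group `T_n`, as a set of circle homeomorphisms. -/
def TnSet (n : ℕ) : Set (Circle ≃ₜ Circle) := { f | InT n f }


lemma isNAdic_int (n : ℕ) (m : ℤ) : IsNAdic n (m : ℝ) := ⟨m, 0, by simp⟩

lemma isNAdic_add {n : ℕ} (hn : 2 ≤ n) {x y : ℝ} (hx : IsNAdic n x) (hy : IsNAdic n y) :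
    IsNAdic n (x + y) := by
  obtain ⟨a, k, rfl⟩ := hx
  obtain ⟨b, l, rfl⟩ := hy
  have h0 : (n : ℝ) ≠ 0 := by positivity
  refine ⟨a * n ^ l + b * n ^ k, k + l, ?_⟩
  push_cast
  rw [pow_add]
  field_simp

lemma isNAdic_int_mul {n : ℕ} (m : ℤ) {x : ℝ} (hx : IsNAdic n x) : IsNAdic n (m * x) := by
  obtain ⟨a, k, rfl⟩ := hx
  exact ⟨m * a, k, by push_cast; ring⟩

lemma isNAdic_neg {n : ℕ} {x : ℝ} (hx : IsNAdic n x) : IsNAdic n (-x) := by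
  obtain ⟨a, k, rfl⟩ := hx
  exact ⟨-a, k, by push_cast; ring⟩

lemma isNAdic_sub {n : ℕ} (hn : 2 ≤ n) {x y : ℝ} (hx : IsNAdic n x) (hy : IsNAdic n y) :
    IsNAdic n (x - y) := by
  rw [sub_eq_add_neg]; exact isNAdic_add hn hx (isNAdic_neg hy)

/-- The ideal generated by `n - 1`. -/
def InM (n : ℕ) (x : ℝ) : Prop := ∃ y, IsNAdic n y ∧ x = ((n : ℝ) - 1) * y

lemma inM_add {n : ℕ} (hn : 2 ≤ n) {x y : ℝ} (hx : InM n x) (hy : InM n y) : InM n (x + y) := by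
  obtain ⟨a, ha, rfl⟩ := hx
  obtain ⟨b, hb, rfl⟩ := hy
  exact ⟨a + b, isNAdic_add hn ha hb, by ring⟩

lemma inM_zero (n : ℕ) : InM n 0 := ⟨0, ⟨0, 0, by simp⟩, by simp⟩

lemma inM_pow {n : ℕ} (s : ℕ) {x : ℝ} (hx : IsNAdic n x) :
    InM n ((n : ℝ) ^ s * x - x) := by
  have h : ((n : ℤ) - 1) ∣ (n : ℤ) ^ s - 1 := sub_one_dvd_pow_sub_one _ _
  obtain ⟨c, hc⟩ := h
  refine ⟨c * x, isNAdic_int_mul c hx, ?_⟩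
  have hc' : (n : ℝ) ^ s - 1 = ((n : ℝ) - 1) * c := by exact_mod_cast hc
  rw [← mul_assoc, ← hc']; ring

lemma isNAdic_zpow {n : ℕ} (hn : 2 ≤ n) (s : ℕ) {x : ℝ} (hx : IsNAdic n x) :
    IsNAdic n (((n : ℝ) ^ s)⁻¹ * x) := by
  obtain ⟨a, k, rfl⟩ := hx
  have h0 : (n : ℝ) ≠ 0 := by positivity
  refine ⟨a, s + k, ?_⟩
  rw [pow_add]
  field_simp

lemma inM_neg {n : ℕ} {x : ℝ} (hx : InM n x) : InM n (-x) := by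
  obtain ⟨a, ha, rfl⟩ := hx
  exact ⟨-a, isNAdic_neg ha, by ring⟩

lemma inM_zpow {n : ℕ} (hn : 2 ≤ n) (s : ℤ) {x : ℝ} (hx : IsNAdic n x) :
    InM n ((n : ℝ) ^ s * x - x) := by
  obtain ⟨k, rfl | rfl⟩ := s.eq_nat_or_neg
  · rw [zpow_natCast]; exact inM_pow k hx
  · have h0 : (n : ℝ) ≠ 0 := by positivity
    rw [zpow_neg, zpow_natCast]
    have := inM_neg (inM_pow k (isNAdic_zpow hn k hx))
    convert this using 1
    field_simp
    ring

lemma commute_int {F : ℝ → ℝ} (h : ∀ x : ℝ, F (x + 1) = F x + 1) (x : ℝ) (m : ℤ) :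
    F (x + m) = F x + m := by
  induction m using Int.induction_on with
  | zero => simp
  | succ i ih => push_cast at ih ⊢; rw [← add_assoc, h, ih]; ring
  | pred i ih =>
    push_cast at ih ⊢
    have := h (x + (-(i : ℝ) - 1))
    rw [show x + (-(i : ℝ) - 1) + 1 = x + -(i : ℝ) by ring, ih] at this
    linarith

lemma key {n : ℕ} (hn : 2 ≤ n) {F : ℝ → ℝ} (hF : PiecewiseNAffine n F) {x : ℝ}
    (hx : IsNAdic n x) : InM n (F x - x - F 0) := by
  obtain ⟨h1, m, t, slope, c, hm, t0, tm, hlt, hna, haff⟩ := hF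
  have step : ∀ i, i < m → ∀ y ∈ Set.Icc (t i) (t (i + 1)), IsNAdic n y →
      InM n (F (t i) - t i - F 0) → InM n (F y - y - F 0) := by
    intro i hi y hy hny hM
    have h2 := inM_add hn hM (inM_zpow hn (slope i) (isNAdic_sub hn hny (hna i hi.le)))
    convert h2 using 1
    rw [haff i hi y hy, haff i hi (t i) ⟨le_rfl, (hlt i hi).le⟩]
    ring
  have ht : ∀ i, i ≤ m → InM n (F (t i) - t i - F 0) := by
    intro i
    induction i with
    | zero => intro _; rw [t0]; convert inM_zero n using 1; ring
    | succ i ih =>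
      intro hi
      exact step i hi _ ⟨(hlt i hi).le, le_rfl⟩ (hna _ hi) (ih (by omega))
  have hloc : ∀ j, j ≤ m → ∀ y, 0 ≤ y → y ≤ t j → IsNAdic n y → InM n (F y - y - F 0) := by
    intro j
    induction j with
    | zero =>
      intro _ y hy0 hy1 _
      rw [t0] at hy1
      obtain rfl : y = 0 := le_antisymm hy1 hy0
      convert inM_zero n using 1; ring
    | succ j ih =>
      intro hj y hy0 hy1 hny
      rcases le_total y (t j) with h | h
      · exact ih (by omega) y hy0 h hny
      · exact step j hj y ⟨h, hy1⟩ hny (ht j (by omega))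
  have hfr : IsNAdic n (Int.fract x) := by
    rw [← Int.self_sub_floor]; exact isNAdic_sub hn hx (isNAdic_int n _)
  have := hloc m le_rfl (Int.fract x) (Int.fract_nonneg x)
    (by rw [tm]; exact (Int.fract_lt_one x).le) hfr
  convert this using 1
  conv_lhs => rw [← Int.fract_add_floor x, commute_int h1]
  ring

lemma coe_eq_iff {x y : ℝ} : ((x : ℝ) : Circle) = (y : Circle) ↔ ∃ m : ℤ, x = y + m := by
  rw [QuotientAddGroup.eq, AddSubgroup.mem_zmultiples_iff]
  constructor
  · rintro ⟨m, hm⟩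
    refine ⟨-m, ?_⟩
    simp only [zsmul_eq_mul, mul_one] at hm
    push_cast
    linarith
  · rintro ⟨m, hm⟩
    refine ⟨-m, ?_⟩
    simp only [zsmul_eq_mul, mul_one]
    push_cast
    linarith

lemma lift_iterate {f : Circle ≃ₜ Circle} {F : ℝ → ℝ} (h : IsLift f F) (j : ℕ) (x : ℝ) :
    (f ^ j) (x : Circle) = ((F^[j] x : ℝ) : Circle) := by
  induction j generalizing x with
  | zero => rfl
  | succ j ih =>
    rw [pow_succ, Function.iterate_succ_apply, ← ih, ← h]
    rfl

lemma main_part (n : ℕ) (hn : 2 ≤ n) (d : ℕ) (hd : 1 ≤ d)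
    (hgcd : 1 < Nat.gcd d (n - 1)) (f : Circle ≃ₜ Circle) (hf : f ∈ TnSet n) :
    orderOf f ≠ d := by
  intro hord
  obtain ⟨himg, F, hmono, hlift, hpa⟩ := hf
  have h1 := hpa.1
  obtain ⟨q, hq⟩ : ∃ q, q = Nat.gcd d (n - 1) := ⟨_, rfl⟩
  rw [← hq] at hgcd
  have hqd : q ∣ d := hq ▸ Nat.gcd_dvd_left _ _
  have hqn : q ∣ n - 1 := hq ▸ Nat.gcd_dvd_right _ _
  have hfd : f ^ d = 1 := hord ▸ pow_orderOf_eq_one f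
  have hit1 : ∀ j (x : ℝ), F^[j] (x + 1) = F^[j] x + 1 := by
    intro j
    induction j with
    | zero => intro x; rfl
    | succ j ih => intro x; rw [Function.iterate_succ_apply, h1, ih]; rfl
  have hint : ∀ x : ℝ, ∃ m : ℤ, F^[d] x = x + m := by
    intro x
    rw [← coe_eq_iff, ← lift_iterate hlift, hfd]
    rfl
  obtain ⟨k, hk⟩ := hint 0
  rw [zero_add] at hk
  have hmd : StrictMono F^[d] := hmono.iterate d
  have hall : ∀ x : ℝ, F^[d] x = x + k := by
    have h01 : ∀ x : ℝ, 0 ≤ x → x < 1 → F^[d] x = x + k := by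
      intro x hx0 hx1
      obtain ⟨m, hm⟩ := hint x
      have a1 : F^[d] 0 ≤ F^[d] x := hmd.monotone hx0
      have a2 : F^[d] x < F^[d] (0 + 1) := hmd (by simpa using hx1)
      rw [hit1, hk] at a2
      rw [hk] at a1
      rw [hm] at a1 a2
      have b1 : k < m + 1 := by
        have : (k : ℝ) < m + 1 := by linarith
        exact_mod_cast this
      have b2 : m < k + 1 := by
        have : (m : ℝ) < k + 1 := by linarith
        exact_mod_cast this
      obtain rfl : m = k := by omega
      exact hm
    intro x
    have := h01 (Int.fract x) (Int.fract_nonneg x) (Int.fract_lt_one x)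
    rw [← Int.fract_add_floor x, commute_int (hit1 d), this]
    ring
  have hFn : ∀ x, IsNAdic n x → IsNAdic n (F x) := by
    intro x hx
    have : f (x : Circle) ∈ nAdicPoints n := by
      rw [← himg]; exact ⟨_, ⟨x, hx, rfl⟩, rfl⟩
    obtain ⟨y, hy, hxy⟩ := this
    rw [hlift, coe_eq_iff] at hxy
    obtain ⟨m, hm⟩ := hxy
    rw [hm]
    exact isNAdic_add hn hy (isNAdic_int n m)
  have h0n : IsNAdic n 0 := ⟨0, 0, by simp⟩
  have horb : ∀ j, IsNAdic n (F^[j] 0) ∧ InM n (F^[j] 0 - j * F 0) := by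
    intro j
    induction j with
    | zero => refine ⟨h0n, ?_⟩; convert inM_zero n using 1; simp
    | succ j ih =>
      rw [Function.iterate_succ_apply']
      refine ⟨hFn _ ih.1, ?_⟩
      convert inM_add hn ih.2 (key hn hpa ih.1) using 1
      push_cast; ring
  have hqk : (q : ℤ) ∣ k := by
    obtain ⟨y, hy, hy'⟩ := (horb d).2
    obtain ⟨e, rfl⟩ := hqd
    obtain ⟨g, hg⟩ := hqn
    have hg' : (n : ℝ) - 1 = q * g := by
      have : n = q * g + 1 := by omega
      rw [this]; push_cast; ring
    have hz : IsNAdic n ((e : ℤ) * F 0 + (g : ℤ) * y) :=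
      isNAdic_add hn (isNAdic_int_mul _ (hFn 0 h0n)) (isNAdic_int_mul _ hy)
    obtain ⟨a, l, hal⟩ := hz
    have hkq : (k : ℝ) = q * (a / (n : ℝ) ^ l) := by
      rw [← hal, ← hk]
      rw [hg'] at hy'
      push_cast at hy' ⊢
      linarith
    have h0 : (n : ℝ) ≠ 0 := by positivity
    have hkn : k * (n : ℤ) ^ l = q * a := by
      have : (k : ℝ) * (n : ℝ) ^ l = q * a := by
        rw [hkq]; field_simp
      exact_mod_cast this
    have hcop : IsCoprime (q : ℤ) ((n : ℤ) ^ l) := by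
      apply IsCoprime.pow_right
      refine ⟨-g, 1, ?_⟩
      have : (n : ℤ) = q * g + 1 := by
        have : n = q * g + 1 := by omega
        exact_mod_cast this
      rw [this]; ring
    exact hcop.dvd_of_dvd_mul_right ⟨a, hkn⟩
  obtain ⟨l, rfl⟩ := hqk
  obtain ⟨e, rfl⟩ := hqd
  have he : 0 < e := by
    rcases Nat.eq_zero_or_pos e with h | h
    · subst h; omega
    · exact h
  have hG : ∀ x, F^[e] x = x + l := by
    intro x
    have hc : Function.Commute (F^[e]) (fun x : ℝ => x + l) := by
      intro y
      exact commute_int (hit1 e) y l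
    have hs : StrictMono (fun x : ℝ => x + l) := fun a b hab => by simpa using hab
    have := (hc.iterate_pos_eq_iff_map_eq (hmono.iterate e).monotone hs (x := x) (n := q)
      (by omega)).1
    apply this
    rw [← Function.iterate_mul, mul_comm e q, hall, add_right_iterate]
    push_cast
    simp
  have hfe : f ^ e = 1 := by
    apply Homeomorph.ext
    intro p
    induction p using QuotientAddGroup.induction_on with
    | H x =>
      have h2 := lift_iterate hlift e x
      have h3 : ((F^[e] x : ℝ) : Circle) = (x : Circle) := coe_eq_iff.2 ⟨l, hG x⟩
      exact h2.trans h3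
  have hdvd := Nat.le_of_dvd he (orderOf_dvd_of_pow_eq_one hfe)
  rw [hord] at hdvd
  nlinarith

/-- Let `n ≥ 2` and let `d ≥ 1` be an integer with `gcd(d, n-1) > 1`.
Then `T_n` contains no element of order `d`.  In particular, for `n > 2` the group `T_n`
contains no element of order `n - 1`. -/
theorem no_element_of_order_gcd (n : ℕ) (hn : 2 ≤ n) (d : ℕ) (hd : 1 ≤ d)
    (hgcd : 1 < Nat.gcd d (n - 1)) :
    (∀ f : Circle ≃ₜ Circle, f ∈ TnSet n → orderOf f ≠ d) ∧
    (∀ n' : ℕ, 2 < n' → ∀ f : Circle ≃ₜ Circle, f ∈ TnSet n' → orderOf f ≠ n' - 1) := by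
  refine ⟨main_part n hn d hd hgcd, fun n' hn' f hf => ?_⟩
  exact main_part n' (by omega) (n' - 1) (by omega) (by rw [Nat.gcd_self]; omega) f hf

end ThompsonPaper
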